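/- arXiv:0808.3204 — 2 statements merged into one kernel-verified Lean document; each statement's English description precedes it below -/
import Mathlib

section
/- The 15 polynomial functions tr x, tr x², tr y², tr x³, tr xy², tr x²y², tr (xy)², tr y⁴, tr x²yxy, tr xy⁴, tr (x²y)², tr x²y²xy, tr xy³xy, tr y⁶, tr (xy³)², evaluated on pairs (x, y) with x ∈ 𝔭 ⊂ M_6(ℂ) and y ∈ 𝔨 = sp_6 ⊂ M_6(ℂ), are algebraically independent over ℂ. -/
open Matrix

noncomputable def J (n : ℕ) : Matrix (Fin n ⊕ Fin n) (Fin n ⊕ Fin n) ℂ :=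
  Matrix.fromBlocks 0 (-1) 1 0

noncomputable def sadj (n : ℕ) (X : Matrix (Fin n ⊕ Fin n) (Fin n ⊕ Fin n) ℂ) :
    Matrix (Fin n ⊕ Fin n) (Fin n ⊕ Fin n) ℂ :=
  (J n)⁻¹ * Xᵀ * J n

/-- The space of pairs `(x, y)` with `x ∈ 𝔭` and `y ∈ 𝔨 = sp₆` inside `M₆(ℂ)`. -/
def PK : Type :=
  {x : Matrix (Fin 3 ⊕ Fin 3) (Fin 3 ⊕ Fin 3) ℂ // sadj 3 x = x} ×
  {y : Matrix (Fin 3 ⊕ Fin 3) (Fin 3 ⊕ Fin 3) ℂ // sadj 3 y = -y}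

/-- The 15 trace functions on `𝔭 × 𝔨` forming the tentative HSOP. -/
noncomputable def hsopFuns : Fin 15 → (PK → ℂ) :=
  ![fun p => Matrix.trace p.1.1,
    fun p => Matrix.trace (p.1.1 ^ 2),
    fun p => Matrix.trace (p.2.1 ^ 2),
    fun p => Matrix.trace (p.1.1 ^ 3),
    fun p => Matrix.trace (p.1.1 * p.2.1 ^ 2),
    fun p => Matrix.trace (p.1.1 ^ 2 * p.2.1 ^ 2),
    fun p => Matrix.trace ((p.1.1 * p.2.1) ^ 2),
    fun p => Matrix.trace (p.2.1 ^ 4),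
    fun p => Matrix.trace (p.1.1 ^ 2 * p.2.1 * p.1.1 * p.2.1),
    fun p => Matrix.trace (p.1.1 * p.2.1 ^ 4),
    fun p => Matrix.trace ((p.1.1 ^ 2 * p.2.1) ^ 2),
    fun p => Matrix.trace (p.1.1 ^ 2 * p.2.1 ^ 2 * p.1.1 * p.2.1),
    fun p => Matrix.trace (p.1.1 * p.2.1 ^ 3 * p.1.1 * p.2.1),
    fun p => Matrix.trace (p.2.1 ^ 6),
    fun p => Matrix.trace ((p.1.1 * p.2.1 ^ 3) ^ 2)]


section Words

variable {σ R S : Type*} [Ring R] [Ring S]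

/-- The derivative in direction `d`, at the point `m`, of the noncommutative monomial `w`. -/
def wordDeriv (m d : σ → R) : List σ → R
  | [] => 0
  | c :: w => d c * (w.map m).prod + m c * wordDeriv m d w

/-- The cyclic derivative with respect to the letter `a`, at the point `m`, of the noncommutative
monomial `w`, where every term carries an extra factor `P` standing for a prefix of `w`. -/
def wordGrad [DecidableEq σ] (m : σ → R) (a : σ) : R → List σ → R
  | _, [] => 0
  | P, c :: w => (if c = a then (w.map m).prod * P else 0) + wordGrad m a (P * m c) w

theorem map_wordDeriv (f : R →+* S) (m d : σ → R) (w : List σ) :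
    f (wordDeriv m d w) = wordDeriv (fun c => f (m c)) (fun c => f (d c)) w := by
  induction w with
  | nil => simp [wordDeriv]
  | cons c w ih => simp [wordDeriv, ih, map_list_prod, Function.comp_def]

theorem trace_mul_wordDeriv {n : Type*} [Fintype n] [DecidableEq n] {k : Type*} [CommRing k]
    [Fintype σ] [DecidableEq σ] (m d : σ → Matrix n n k) (P : Matrix n n k) (w : List σ) :
    trace (P * wordDeriv m d w) = ∑ a, trace (wordGrad m a P w * d a) := by
  induction w generalizing P with
  | nil => simp [wordDeriv, wordGrad]
  | cons c w ih =>
    simp only [wordDeriv, wordGrad, mul_add, add_mul, trace_add, Finset.sum_add_distrib, ite_mul,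
      zero_mul, ← Matrix.mul_assoc, ih]
    congr 1
    rw [Finset.sum_eq_single c (fun a _ h => by simp [h.symm]) (by simp), if_pos rfl,
      trace_mul_comm, ← Matrix.mul_assoc]

theorem exists_hasStrictFDerivAt_map_prod {𝕜 E A : Type*} [NontriviallyNormedField 𝕜]
    [NormedAddCommGroup E] [NormedSpace 𝕜 E] [NormedRing A] [NormedAlgebra 𝕜 A]
    {f : σ → E → A} {f' : σ → E →L[𝕜] A} {x : E} (hf : ∀ c, HasStrictFDerivAt (f c) (f' c) x)
    (w : List σ) :
    ∃ L : E →L[𝕜] A, HasStrictFDerivAt (fun v => (w.map fun c => f c v).prod) L x ∧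
      ∀ h, L h = wordDeriv (fun c => f c x) (fun c => f' c h) w := by
  induction w with
  | nil => exact ⟨0, by simpa using hasStrictFDerivAt_const (1 : A) x, by simp [wordDeriv]⟩
  | cons c w ih =>
    obtain ⟨L, hL, hL'⟩ := ih
    refine ⟨_, (hf c).mul' hL, fun h => ?_⟩
    simp [wordDeriv, hL', add_comm, List.prod]

end Words

/-- Jacobian criterion: functions whose restrictions along `g` have a surjective joint derivative
at some point are algebraically independent. -/
theorem algebraicIndependent_of_hasStrictFDerivAt {ι α 𝕜 E : Type*} [Fintype ι] [RCLike 𝕜]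
    [NormedAddCommGroup E] [NormedSpace 𝕜 E] [CompleteSpace E]
    {f : ι → α → 𝕜} {g : E → α} {F' : E →L[𝕜] (ι → 𝕜)} {x : E}
    (hF : HasStrictFDerivAt (fun v k => f k (g v)) F' x) (hs : Function.Surjective F') :
    AlgebraicIndependent 𝕜 f := by
  rw [algebraicIndependent_iff]
  intro p hp
  have hmap := hF.map_nhds_eq_of_surj (LinearMap.range_eq_top.2 hs)
  have hzero (v : E) : MvPolynomial.eval (fun k => f k (g v)) p = 0 := by
    have := congrArg (Pi.evalAlgHom 𝕜 (fun _ : α => 𝕜) (g v)) hp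
    rw [← AlgHom.comp_apply, MvPolynomial.comp_aeval] at this
    simpa [MvPolynomial.aeval_eq_eval] using this
  have hmem : {z : ι → 𝕜 | MvPolynomial.eval z p = 0} ∈ nhds (fun k => f k (g x)) := by
    rw [← hmap, Filter.mem_map]
    exact Filter.univ_mem' hzero
  obtain ⟨ε, hε, hball⟩ := Metric.mem_nhds_iff.1 hmem
  refine MvPolynomial.funext_set (fun k => Metric.ball (f k (g x)) ε)
    (fun k => infinite_of_mem_nhds _ (Metric.ball_mem_nhds _ hε)) fun z hz => ?_
  rw [map_zero]
  apply hball
  rw [ball_pi _ hε]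
  exact hz

section Slice

/-- A pair `(x, y)`, indexed by `false` and `true`, in `𝔭 × 𝔨`. -/
def basePoint (R : Type*) [Ring R] : Bool → Matrix (Fin 3 ⊕ Fin 3) (Fin 3 ⊕ Fin 3) R
  | false => fromBlocks (diagonal ![0, 1, 2]) 0 0 (diagonal ![0, 1, 2])
  | true => fromBlocks !![0, 0, 1; 1, 0, 0; 1, 1, 0] (diagonal ![1, 0, 1]) (diagonal ![0, 1, 0])
      (-!![0, 0, 1; 1, 0, 0; 1, 1, 0]ᵀ)

/-- A 15-dimensional linear subspace of `𝔭 × 𝔨`, transversal at `basePoint` to its orbit. -/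
def direction {R : Type*} [Ring R] (v : Fin 15 → R) :
    Bool → Matrix (Fin 3 ⊕ Fin 3) (Fin 3 ⊕ Fin 3) R
  | false => fromBlocks (diagonal ![v 0, v 1, v 2]) 0 0 (diagonal ![v 0, v 1, v 2])
  | true => fromBlocks !![v 3, v 4, v 5; v 6, v 7, v 8; v 9, v 10, v 11] (diagonal ![0, v 13, 0])
      (diagonal ![v 12, 0, v 14]) (-!![v 3, v 4, v 5; v 6, v 7, v 8; v 9, v 10, v 11]ᵀ)

theorem basePoint_map {R S : Type*} [Ring R] [Ring S] (f : R →+* S) (c : Bool) :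
    (basePoint R c).map f = basePoint S c := by
  cases c <;> ext (i | i) (j | j) <;> fin_cases i <;> fin_cases j <;> 
    simp [basePoint, map_ofNat]

theorem direction_map {R S : Type*} [Ring R] [Ring S] (f : R →+* S) (v : Fin 15 → R) (c : Bool) :
    (direction v c).map f = direction (fun i => f (v i)) c := by
  cases c <;> ext (i | i) (j | j) <;> fin_cases i <;> fin_cases j <;> simp [direction]

/-- `direction` as a linear map. -/
def directionLinear (R : Type*) [CommRing R] (c : Bool) :
    (Fin 15 → R) →ₗ[R] Matrix (Fin 3 ⊕ Fin 3) (Fin 3 ⊕ Fin 3) R where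
  toFun v := direction v c
  map_add' v w := by
    cases c <;> ext (i | i) (j | j) <;> fin_cases i <;> fin_cases j <;>
      simp [direction, add_comm]
  map_smul' r v := by
    cases c <;> ext (i | i) (j | j) <;> fin_cases i <;> fin_cases j <;> simp [direction]

theorem sadj_fromBlocks (n : ℕ) (A B C D : Matrix (Fin n) (Fin n) ℂ) :
    sadj n (fromBlocks A B C D) = fromBlocks Dᵀ (-Bᵀ) (-Cᵀ) Aᵀ := by
  have hJ : (_root_.J n)⁻¹ = fromBlocks 0 1 (-1) 0 :=
    Matrix.inv_eq_left_inv (by simp [_root_.J, fromBlocks_multiply])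
  rw [sadj, hJ, _root_.J]
  simp [fromBlocks_transpose, fromBlocks_multiply]

theorem sadj_add (n : ℕ) (X Y : Matrix (Fin n ⊕ Fin n) (Fin n ⊕ Fin n) ℂ) :
    sadj n (X + Y) = sadj n X + sadj n Y := by
  simp [sadj, Matrix.mul_add, Matrix.add_mul]

/-- The affine slice through `basePoint` in the directions `direction`. -/
noncomputable def slice (v : Fin 15 → ℂ) : PK :=
  ⟨⟨basePoint ℂ false + direction v false, by
      simp only [basePoint, direction, sadj_add, sadj_fromBlocks, diagonal_transpose,
        transpose_zero, neg_zero]⟩,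
    ⟨basePoint ℂ true + direction v true, by
      simp only [basePoint, direction, sadj_add, sadj_fromBlocks, diagonal_transpose,
        transpose_neg, transpose_transpose, neg_add, fromBlocks_neg, neg_neg]⟩⟩

/-- The words in `x = false` and `y = true` whose traces are the functions `hsopFuns`. -/
def hsopWords : Fin 15 → List Bool :=
  ![[false], [false, false], [true, true], [false, false, false], [false, true, true],
    [false, false, true, true], [false, true, false, true], [true, true, true, true],
    [false, false, true, false, true], [false, true, true, true, true],
    [false, false, true, false, false, true], [false, false, true, true, false, true],
    [false, true, true, true, false, true], [true, true, true, true, true, true],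
    [false, true, true, true, false, true, true, true]]

theorem hsopFuns_eq_trace_prod (k : Fin 15) (p : PK) :
    hsopFuns k p = trace ((hsopWords k).map fun c => cond c p.2.1 p.1.1).prod := by
  fin_cases k <;> simp [hsopFuns, hsopWords] <;>
    simp only [pow_succ, pow_zero, one_mul, Matrix.mul_assoc]

theorem hsopFuns_slice (k : Fin 15) (v : Fin 15 → ℂ) :
    hsopFuns k (slice v) =
      trace ((hsopWords k).map fun c => basePoint ℂ c + direction v c).prod := by
  rw [hsopFuns_eq_trace_prod]
  congr 3
  ext1 c
  cases c <;> rfl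

/-- The Jacobian matrix of `hsopFuns` along `slice` at `basePoint`. -/
def hsopJacobian : Matrix (Fin 15) (Fin 15) ℤ :=
  !![2, 2, 2, 0, 0, 0, 0, 0, 0, 0, 0, 0, 0, 0, 0;
    0, 4, 8, 0, 0, 0, 0, 0, 0, 0, 0, 0, 0, 0, 0;
    0, 0, 0, 0, 4, 4, 0, 0, 4, 4, 0, 0, 2, 2, 2;
    0, 6, 24, 0, 0, 0, 0, 0, 0, 0, 0, 0, 0, 0, 0;
    2, 0, 2, 0, 2, 4, 0, 0, 6, 4, 0, 0, 0, 2, 4;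
    0, 0, 8, 0, 2, 8, 0, 0, 10, 8, 0, 0, 0, 2, 8;
    8, 0, 0, 0, 0, 0, 0, 0, 8, 0, 0, 0, 0, 2, 8;
    0, 0, 0, 8, 8, 8, -8, 8, 8, 8, 0, 8, 4, 0, 4;
    8, 0, 0, 0, 0, 0, 0, 0, 12, 0, 0, 0, 0, 2, 16;
    0, -2, 2, 6, 6, 8, -4, 8, 10, 8, 0, 10, 0, 0, 8;
    0, 0, 0, 0, 0, 0, 0, 0, 16, 0, 0, 0, 0, 2, 32;
    3, 0, -3, 0, 0, -2, -2, 0, 0, 0, -2, 0, 0, 0, 0;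
    6, -2, 0, 4, 0, 0, -2, 6, 8, 0, 0, 12, -4, 0, 12;
    0, 0, 0, 24, 0, 24, 0, 12, 0, 0, 12, 24, 0, -6, 12;
    4, 4, 8, 24, -4, 28, 20, 8, 4, -8, 20, 40, -8, -2, 18]

/-- An inverse of `hsopJacobian` modulo `5`. -/
def hsopJacobianInvMod : Matrix (Fin 15) (Fin 15) ℤ :=
  !![-2, -1, 0, -2, 0, 0, 0, 0, 0, 0, 0, 0, 0, 0, 0;
    0, -2, 0, -1, 0, 0, 0, 0, 0, 0, 0, 0, 0, 0, 0;
    0, -2, 0, -2, 0, 0, 0, 0, 0, 0, 0, 0, 0, 0, 0;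
    -2, 0, -1, 2, 1, 1, 1, -1, 2, -1, -1, -2, -2, -2, -1;
    0, 1, 0, 1, 1, 2, 1, 0, 0, 0, 1, 0, 0, 0, 0;
    1, -2, -1, -2, 2, 0, 1, -2, -2, 0, 1, 0, -2, 0, 1;
    1, -2, 2, -2, 1, 0, -2, 0, 0, -2, -2, -1, 2, -1, 2;
    2, -1, -2, -1, -2, 0, 2, 2, -2, -2, 0, 1, 0, 1, -2;
    -1, 2, 0, -1, 0, 0, 2, 0, 2, 0, 1, 0, 0, 0, 0;
    1, 1, 1, 2, -1, -1, 0, 2, -1, 0, 1, 0, 2, 0, -1;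
    0, -2, -1, -1, 2, 0, 1, 2, 2, 2, 1, -2, 0, 1, 2;
    1, -1, 1, 2, 2, -1, 1, 1, -1, 1, -2, 0, -1, 0, 0;
    0, 2, -2, 2, 1, -2, -2, 0, -2, 0, 2, 0, 0, 0, 0;
    0, 0, 0, 0, 0, 0, 2, 0, -2, 0, -2, 0, 0, 0, 0;
    -2, -1, 0, -2, 0, 0, 2, 0, 1, 0, 2, 0, 0, 0, 0]

set_option maxRecDepth 100000 in
theorem hsopJacobian_mul_invMod (i j : Fin 15) :
    ((hsopJacobian * hsopJacobianInvMod) i j - if i = j then 1 else 0) % 5 = 0 := by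
  revert i j
  decide +kernel

theorem det_hsopJacobian_ne_zero : hsopJacobian.det ≠ 0 := by
  have h : (Int.castRingHom (ZMod 5)).mapMatrix hsopJacobian *
      (Int.castRingHom (ZMod 5)).mapMatrix hsopJacobianInvMod = 1 := by
    rw [← map_mul]
    ext i j
    have := (ZMod.intCast_zmod_eq_zero_iff_dvd _ 5).2
      (Int.dvd_of_emod_eq_zero (hsopJacobian_mul_invMod i j))
    rw [Int.cast_sub, sub_eq_zero] at this
    simpa [Matrix.one_apply] using this
  have hdet := congrArg Matrix.det h
  rw [det_mul, det_one, ← RingHom.map_det] at hdet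
  intro h0
  rw [h0, map_zero, zero_mul] at hdet
  exact absurd hdet (by decide)

set_option maxRecDepth 100000 in
theorem wordGrad_eq_hsopJacobian :
    (Matrix.of fun k i : Fin 15 =>
      trace (wordGrad (basePoint ℤ) true 1 (hsopWords k) * direction (Pi.single i 1) true) +
      trace (wordGrad (basePoint ℤ) false 1 (hsopWords k) * direction (Pi.single i 1) false)) =
    hsopJacobian := by
  decide +kernel

theorem trace_wordDeriv_eq_hsopJacobian (k i : Fin 15) :
    trace (wordDeriv (basePoint ℂ) (direction (Pi.single i 1)) (hsopWords k)) =
      (hsopJacobian k i : ℂ) := by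
  have hd (c : Bool) : (direction (Pi.single i (1 : ℤ)) c).map (Int.castRingHom ℂ) =
      direction (Pi.single i 1) c := by
    rw [direction_map]
    congr 1
    ext j
    simp [Pi.single_apply]
  have h := map_wordDeriv (Int.castRingHom ℂ).mapMatrix (basePoint ℤ)
    (direction (Pi.single i 1)) (hsopWords k)
  simp only [RingHom.mapMatrix_apply, basePoint_map, hd] at h
  rw [← wordGrad_eq_hsopJacobian, of_apply, ← Fintype.sum_bool (fun c =>
    trace (wordGrad (basePoint ℤ) c 1 (hsopWords k) * direction (Pi.single i 1) c)),
    ← trace_mul_wordDeriv, one_mul, ← h, ← eq_intCast (Int.castRingHom ℂ)]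
  exact (AddMonoidHom.map_trace (Int.castRingHom ℂ) _).symm

end Slice

section Jacobian

attribute [local instance] Matrix.linftyOpNormedRing Matrix.linftyOpNormedAlgebra

theorem exists_hasStrictFDerivAt_hsopFuns_slice :
    ∃ F' : (Fin 15 → ℂ) →L[ℂ] (Fin 15 → ℂ),
      HasStrictFDerivAt (fun v k => hsopFuns k (slice v)) F' 0 ∧
      ∀ k i, F' (Pi.single i 1) k = (hsopJacobian k i : ℂ) := by
  have hf (c : Bool) : HasStrictFDerivAt (fun v => basePoint ℂ c + direction v c)
      (LinearMap.toContinuousLinearMap (directionLinear ℂ c)) 0 :=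
    (LinearMap.toContinuousLinearMap (directionLinear ℂ c)).hasStrictFDerivAt.const_add _
  have hzero (c : Bool) : direction (0 : Fin 15 → ℂ) c = 0 := (directionLinear ℂ c).map_zero
  choose L hL hL' using fun k => exists_hasStrictFDerivAt_map_prod hf (hsopWords k)
  let T := LinearMap.toContinuousLinearMap (traceLinearMap (Fin 3 ⊕ Fin 3) ℂ ℂ)
  refine ⟨ContinuousLinearMap.pi fun k => T.comp (L k), ?_, fun k i => ?_⟩
  · rw [hasStrictFDerivAt_pi]
    intro k
    simp only [hsopFuns_slice]
    exact T.hasStrictFDerivAt.comp _ (hL k)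
  · rw [← trace_wordDeriv_eq_hsopJacobian]
    change trace (L k (Pi.single i 1)) = _
    rw [hL']
    simp only [hzero, add_zero]
    rfl

end Jacobian

/-- The 15 trace functions `tr x, tr x², tr y², …, tr (xy³)²` on `𝔭 × 𝔨 ⊂ M₆(ℂ) × M₆(ℂ)`
are algebraically independent over `ℂ`. -/
theorem hsopFuns_algebraicIndependent : AlgebraicIndependent ℂ hsopFuns := by
  obtain ⟨F', hF, hF'⟩ := exists_hasStrictFDerivAt_hsopFuns_slice
  refine algebraicIndependent_of_hasStrictFDerivAt hF ?_
  have hM : (F' : (Fin 15 → ℂ) →ₗ[ℂ] (Fin 15 → ℂ)) =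
      toLin' ((Int.castRingHom ℂ).mapMatrix hsopJacobian) := by
    refine LinearMap.pi_ext' fun i => LinearMap.ext_ring ?_
    ext k
    simp [hF']
  change Function.Surjective (F' : (Fin 15 → ℂ) →ₗ[ℂ] (Fin 15 → ℂ))
  rw [hM]
  refine mulVec_surjective_iff_isUnit.2 ((isUnit_iff_isUnit_det _).2 ?_)
  rw [← RingHom.map_det, isUnit_iff_ne_zero]
  simpa using det_hsopJacobian_ne_zero
end

section
/- Every matrix x ∈ M_{2n}(ℂ) with x* = x (symplectic adjoint x* = J⁻¹xᵀJ) is symplectically similar to a matrix of the form X ⊕ Xᵀ for some X ∈ M_n(ℂ); in particular tr(x^k) = 2 tr(X^k) for all k ≥ 1. -/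
open Matrix

open Module

section Krylov

variable {K V : Type*} [Field K] [AddCommGroup V] [Module K V]

/-- The `T`-invariant subspace generated by `v`. -/
def krylov (T : V →ₗ[K] V) (v : V) : Submodule K V :=
  Submodule.span K (Set.range fun i : ℕ => (T ^ i) v)

/-- The span of the first `k` iterates of `v` under `T`. -/
def truncatedKrylov (T : V →ₗ[K] V) (v : V) (k : ℕ) : Submodule K V :=
  Submodule.span K ((fun i : ℕ => (T ^ i) v) '' Set.Iio k)

lemma pow_mem_krylov (T : V →ₗ[K] V) (v : V) (i : ℕ) : (T ^ i) v ∈ krylov T v :=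
  Submodule.subset_span ⟨i, rfl⟩

lemma self_mem_krylov (T : V →ₗ[K] V) (v : V) : v ∈ krylov T v := by
  simpa using pow_mem_krylov T v 0

lemma map_mem_krylov (T : V →ₗ[K] V) (v : V) {u : V} (hu : u ∈ krylov T v) :
    T u ∈ krylov T v := by
  have h : krylov T v ≤ (krylov T v).comap T := by
    refine Submodule.span_le.2 ?_
    rintro _ ⟨i, rfl⟩
    change T ((T ^ i) v) ∈ krylov T v
    rw [← Module.End.mul_apply, ← pow_succ']
    exact pow_mem_krylov T v (i + 1)
  exact h hu

lemma pow_mem_truncatedKrylov (T : V →ₗ[K] V) (v : V) {i k : ℕ} (h : i < k) :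
    (T ^ i) v ∈ truncatedKrylov T v k :=
  Submodule.subset_span ⟨i, h, rfl⟩

lemma truncatedKrylov_mono (T : V →ₗ[K] V) (v : V) : Monotone (truncatedKrylov T v) :=
  fun _ _ h => Submodule.span_mono (Set.image_mono (Set.Iio_subset_Iio h))

lemma pow_map_mem_truncatedKrylov (T : V →ₗ[K] V) (v : V) {k : ℕ} (j : ℕ) {u : V}
    (hu : u ∈ truncatedKrylov T v k) : (T ^ j) u ∈ truncatedKrylov T v (j + k) := by
  have h : truncatedKrylov T v k ≤ (truncatedKrylov T v (j + k)).comap (T ^ j) := by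
    refine Submodule.span_le.2 ?_
    rintro _ ⟨i, hi, rfl⟩
    change (T ^ j) ((T ^ i) v) ∈ truncatedKrylov T v (j + k)
    rw [← Module.End.mul_apply, ← pow_add]
    exact pow_mem_truncatedKrylov T v (Nat.add_lt_add_left hi j)
  exact h hu

lemma exists_of_mem_truncatedKrylov_succ (T : V →ₗ[K] V) (v : V) {k : ℕ} {u : V}
    (hu : u ∈ truncatedKrylov T v (k + 1)) :
    ∃ (c : K) (s : V), s ∈ truncatedKrylov T v k ∧ u = c • (T ^ k) v + s := by
  have h : Set.Iio (k + 1) = insert k (Set.Iio k) := by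
    ext i; simp only [Set.mem_Iio, Set.mem_insert_iff]; omega
  rw [truncatedKrylov, h, Set.image_insert_eq, Submodule.mem_span_insert] at hu
  exact hu

lemma krylov_le_truncatedKrylov (T : V →ₗ[K] V) (v : V) {d : ℕ}
    (hd : (T ^ d) v ∈ truncatedKrylov T v d) : krylov T v ≤ truncatedKrylov T v d := by
  refine Submodule.span_le.2 ?_
  rintro _ ⟨i, rfl⟩
  change (T ^ i) v ∈ truncatedKrylov T v d
  induction i with
  | zero =>
    rcases Nat.eq_zero_or_pos d with rfl | h
    · exact hd
    · exact pow_mem_truncatedKrylov T v h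
  | succ i ih =>
    have h := pow_map_mem_truncatedKrylov T v 1 ih
    rw [← Module.End.mul_apply, ← pow_add, add_comm 1 i, add_comm 1 d] at h
    obtain ⟨c, s, hs, hcs⟩ := exists_of_mem_truncatedKrylov_succ T v h
    rw [hcs]
    exact add_mem (Submodule.smul_mem _ _ hd) hs

/-- A cyclic subspace carries a functional whose kernel contains no nonzero invariant subspace. -/
lemma exists_dual_separating_krylov [FiniteDimensional K V] (T : V →ₗ[K] V) (v : V) :
    ∃ f : V →ₗ[K] K, ∀ u ∈ krylov T v, (∀ j : ℕ, f ((T ^ j) u) = 0) → u = 0 := by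
  classical
  have hex : ∃ d, (T ^ d) v ∈ truncatedKrylov T v d := by
    obtain ⟨n, hn⟩ := monotone_stabilizes_iff_noetherian.2 (inferInstance : IsNoetherian K V)
      ⟨truncatedKrylov T v, truncatedKrylov_mono T v⟩
    refine ⟨n, ?_⟩
    have h : truncatedKrylov T v n = truncatedKrylov T v (n + 1) := hn (n + 1) (Nat.le_succ n)
    rw [h]
    exact pow_mem_truncatedKrylov T v (Nat.lt_succ_self n)
  have hle := krylov_le_truncatedKrylov T v (Nat.find_spec hex)
  have hmin : ∀ m, m < Nat.find hex → (T ^ m) v ∉ truncatedKrylov T v m :=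
    fun m hm => Nat.find_min hex hm
  generalize Nat.find hex = d at hle hmin
  cases d with
  | zero =>
    refine ⟨0, fun u hu _ => ?_⟩
    simpa [truncatedKrylov] using hle hu
  | succ d =>
    obtain ⟨f, hf, hker⟩ := Submodule.exists_le_ker_of_notMem (hmin d (Nat.lt_succ_self d))
    have key : ∀ k, k ≤ d + 1 → ∀ u ∈ truncatedKrylov T v k,
        (∀ j : ℕ, f ((T ^ j) u) = 0) → u = 0 := by
      intro k
      induction k with
      | zero => intro _ u hu _; simpa [truncatedKrylov] using hu
      | succ k ih =>
        intro hk u hu hfu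
        obtain ⟨c, s, hs, rfl⟩ := exists_of_mem_truncatedKrylov_succ T v hu
        have h1 := pow_map_mem_truncatedKrylov T v (d - k) hs
        rw [Nat.sub_add_cancel (by omega)] at h1
        have h2 : f ((T ^ (d - k)) s) = 0 := hker h1
        have h3 := hfu (d - k)
        rw [map_add, map_add, map_smul, map_smul, h2, add_zero, ← Module.End.mul_apply, ← pow_add,
          Nat.sub_add_cancel (by omega), smul_eq_mul] at h3
        have hc : c = 0 := (mul_eq_zero.1 h3).resolve_right hf
        subst hc
        rw [zero_smul, zero_add] at hfu ⊢
        exact ih (by omega) s hs hfu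
    exact ⟨f, fun u hu => key (d + 1) le_rfl u (hle hu)⟩

end Krylov

section AlternatingForm

variable {K V : Type*} [Field K] [AddCommGroup V] [Module K V]

/-- The map `L → Dual M` induced by a bilinear form. -/
def pairing (B : LinearMap.BilinForm K V) (L M : Submodule K V) : L →ₗ[K] Dual K M :=
  M.dualRestrict ∘ₗ B ∘ₗ L.subtype

lemma pairing_injective {B : LinearMap.BilinForm K V} {L M : Submodule K V}
    (h : ∀ u ∈ L, (∀ w ∈ M, B u w = 0) → u = 0) : Function.Injective (pairing B L M) := by
  rw [← LinearMap.ker_eq_bot, LinearMap.ker_eq_bot']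
  intro u hu
  exact Subtype.ext (h u u.2 fun w hw => LinearMap.congr_fun hu ⟨w, hw⟩)

lemma finrank_le_of_pairing [FiniteDimensional K V] {B : LinearMap.BilinForm K V}
    {L M : Submodule K V} (h : ∀ u ∈ L, (∀ w ∈ M, B u w = 0) → u = 0) :
    finrank K L ≤ finrank K M := by
  simpa [Subspace.dual_finrank_eq] using
    LinearMap.finrank_le_finrank_of_injective (pairing_injective h)

lemma pairing_surjective [FiniteDimensional K V] {B : LinearMap.BilinForm K V}
    {L M : Submodule K V} (h : ∀ u ∈ L, (∀ w ∈ M, B u w = 0) → u = 0)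
    (hdim : finrank K M ≤ finrank K L) : Function.Surjective (pairing B L M) :=
  (LinearMap.injective_iff_surjective_of_finrank_eq_finrank
    ((le_antisymm (finrank_le_of_pairing h) hdim).trans
      Subspace.dual_finrank_eq.symm)).1 (pairing_injective h)

lemma eq_zero_of_pairing [FiniteDimensional K V] {B : LinearMap.BilinForm K V}
    {L M : Submodule K V} (h : ∀ u ∈ L, (∀ w ∈ M, B u w = 0) → u = 0)
    (hdim : finrank K M ≤ finrank K L) :
    ∀ w ∈ M, (∀ u ∈ L, B u w = 0) → w = 0 := by
  intro w hw hLw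
  have hw0 : (⟨w, hw⟩ : M) = 0 := by
    rw [← Module.forall_dual_apply_eq_zero_iff K]
    intro g
    obtain ⟨u, rfl⟩ := pairing_surjective h hdim g
    exact hLw u u.2
  exact congrArg Subtype.val hw0

lemma pow_selfAdjoint {B : LinearMap.BilinForm K V} {T : V →ₗ[K] V}
    (hT : ∀ u w, B (T u) w = B u (T w)) (i : ℕ) (u w : V) :
    B ((T ^ i) u) w = B u ((T ^ i) w) := by
  induction i generalizing u w with
  | zero => simp
  | succ i ih =>
    rw [pow_succ, Module.End.mul_apply, ih, hT, ← Module.End.mul_apply, ← pow_succ', pow_succ]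

lemma krylov_isotropic [NeZero (2 : K)] {B : LinearMap.BilinForm K V} (hB : B.IsAlt)
    {T : V →ₗ[K] V} (hT : ∀ u w, B (T u) w = B u (T w)) (v : V) :
    ∀ u ∈ krylov T v, ∀ w ∈ krylov T v, B u w = 0 := by
  have hv : ∀ m : ℕ, B v ((T ^ m) v) = 0 := by
    intro m
    have h1 : -B v ((T ^ m) v) = B ((T ^ m) v) v := hB.neg_eq _ _
    rw [pow_selfAdjoint hT] at h1
    have h2 : (2 : K) * B v ((T ^ m) v) = 0 := by linear_combination -h1
    exact (mul_eq_zero.1 h2).resolve_left two_ne_zero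
  intro u hu w hw
  induction hu using Submodule.span_induction with
  | zero => simp
  | add a b _ _ ha hb => simp [ha, hb]
  | smul c a _ ha => simp [ha]
  | mem a ha =>
    obtain ⟨i, rfl⟩ := ha
    induction hw using Submodule.span_induction with
    | zero => simp
    | add a b _ _ ha hb => simp [ha, hb]
    | smul c a _ ha => simp [ha]
    | mem a ha =>
      obtain ⟨j, rfl⟩ := ha
      simp only
      rw [pow_selfAdjoint hT, ← Module.End.mul_apply, ← pow_add, hv]

/-- `L` is a `T`-invariant subspace on which `B` vanishes. -/
structure IsInvariantIsotropic (B : LinearMap.BilinForm K V) (T : V →ₗ[K] V)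
    (L : Submodule K V) : Prop where
  map_mem : ∀ u ∈ L, T u ∈ L
  isotropic : ∀ u ∈ L, ∀ w ∈ L, B u w = 0

lemma isInvariantIsotropic_krylov [NeZero (2 : K)] {B : LinearMap.BilinForm K V} (hB : B.IsAlt)
    {T : V →ₗ[K] V} (hT : ∀ u w, B (T u) w = B u (T w)) (v : V) :
    IsInvariantIsotropic B T (krylov T v) :=
  ⟨fun _ => map_mem_krylov T v, krylov_isotropic hB hT v⟩

lemma IsInvariantIsotropic.sup_map {B : LinearMap.BilinForm K V} (hB : B.IsAlt) {T : V →ₗ[K] V}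
    {L W : Submodule K V} (hW : ∀ w ∈ W, T w ∈ W) (hLW : ∀ u ∈ L, ∀ w ∈ W, B u w = 0)
    {M : Submodule K W} (hL : IsInvariantIsotropic B T L)
    (hM : IsInvariantIsotropic (B.restrict W) (T.restrict hW) M) :
    IsInvariantIsotropic B T (L ⊔ M.map W.subtype) := by
  constructor
  · intro u hu
    obtain ⟨a, ha, _, ⟨b, hb, rfl⟩, rfl⟩ := Submodule.mem_sup.1 hu
    rw [map_add]
    exact Submodule.add_mem_sup (hL.map_mem a ha) ⟨_, hM.map_mem b hb, rfl⟩
  · intro u hu w hw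
    obtain ⟨a, ha, _, ⟨b, hb, rfl⟩, rfl⟩ := Submodule.mem_sup.1 hu
    obtain ⟨a', ha', _, ⟨b', hb', rfl⟩, rfl⟩ := Submodule.mem_sup.1 hw
    have h1 : B b b' = 0 := hM.isotropic b hb b' hb'
    have h2 : B b a' = 0 := by rw [hB.eq_iff]; exact hLW a' ha' b b.2
    simp [hL.isotropic a ha a' ha', h1, h2, hLW a ha b' b'.2]

/-- An endomorphism which is self-adjoint for a nondegenerate alternating form admits a pair of
invariant isotropic subspaces which span the whole space. -/
theorem exists_invariantIsotropic_sup_eq_top [NeZero (2 : K)] (N : ℕ) :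
    ∀ (V : Type*) [AddCommGroup V] [Module K V] [FiniteDimensional K V]
      (B : LinearMap.BilinForm K V) (T : V →ₗ[K] V), finrank K V = N → B.IsAlt →
      (∀ u, (∀ w, B u w = 0) → u = 0) → (∀ u w, B (T u) w = B u (T w)) →
      ∃ L M : Submodule K V,
        IsInvariantIsotropic B T L ∧ IsInvariantIsotropic B T M ∧ L ⊔ M = ⊤ := by
  induction N using Nat.strong_induction_on with
  | _ N ih =>
  intro V _ _ _ B T hN hB hnd hT
  rcases subsingleton_or_nontrivial V with hV | hV
  · exact ⟨⊥, ⊥, ⟨by simp, by simp⟩, ⟨by simp, by simp⟩, Subsingleton.elim _ _⟩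
  have hfin : (Set.range fun v => finrank K (krylov T v)).Finite :=
    (Set.finite_Iic (finrank K V)).subset
      (by rintro _ ⟨v, rfl⟩; exact Submodule.finrank_le _)
  obtain ⟨_, ⟨v, rfl⟩, hmax⟩ := Set.exists_max_image _ id hfin (Set.range_nonempty _)
  replace hmax : ∀ w, finrank K (krylov T w) ≤ finrank K (krylov T v) :=
    fun w => hmax _ ⟨w, rfl⟩
  obtain ⟨f, hf⟩ := exists_dual_separating_krylov T v
  have hinj : Function.Injective B := by
    rw [← LinearMap.ker_eq_bot, LinearMap.ker_eq_bot']
    exact fun u hu => hnd u fun w => LinearMap.congr_fun hu w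
  obtain ⟨w, hw⟩ := (LinearMap.injective_iff_surjective_of_finrank_eq_finrank
    Subspace.dual_finrank_eq.symm).1 hinj (-f)
  have hfw : ∀ u, B u w = f u := by
    intro u
    rw [← hB.neg_eq, hw]
    simp
  have hL := isInvariantIsotropic_krylov hB hT v
  have hM := isInvariantIsotropic_krylov hB hT w
  have hpair : ∀ u ∈ krylov T v, (∀ w' ∈ krylov T w, B u w' = 0) → u = 0 := by
    intro u hu h
    refine hf u hu fun j => ?_
    rw [← hfw, pow_selfAdjoint hT]
    exact h _ (pow_mem_krylov T w j)
  have hpair' := eq_zero_of_pairing hpair (hmax w)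
  set L₁ := krylov T v
  set M₁ := krylov T w
  have hdisj : Disjoint (L₁ ⊔ M₁) (B.orthogonal (L₁ ⊔ M₁)) := by
    rw [Submodule.disjoint_def]
    intro u hu hu'
    rw [LinearMap.BilinForm.mem_orthogonal_iff] at hu'
    obtain ⟨a, ha, b, hb, rfl⟩ := Submodule.mem_sup.1 hu
    have hb0 : b = 0 := by
      refine hpair' b hb fun c hc => ?_
      have h : B c (a + b) = 0 := hu' c (Submodule.mem_sup_left hc)
      rwa [map_add, hL.isotropic c hc a ha, zero_add] at h
    have ha0 : a = 0 := by
      refine hpair a ha fun c hc => ?_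
      have h : B c (a + b) = 0 := hu' c (Submodule.mem_sup_right hc)
      rw [map_add, hM.isotropic c hc b hb, add_zero] at h
      rwa [hB.eq_iff]
    simp [ha0, hb0]
  have hcompl := (LinearMap.BilinForm.isCompl_orthogonal_iff_disjoint hB.isRefl).2 hdisj
  set W := B.orthogonal (L₁ ⊔ M₁)
  have horth : ∀ u ∈ L₁ ⊔ M₁, ∀ z ∈ W, B u z = 0 := fun u hu z hz => hz u hu
  have hW : ∀ z ∈ W, T z ∈ W := by
    intro z hz u hu
    change B u (T z) = 0
    rw [← hT]
    refine hz _ ?_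
    obtain ⟨a, ha, b, hb, rfl⟩ := Submodule.mem_sup.1 hu
    rw [map_add]
    exact Submodule.add_mem_sup (hL.map_mem a ha) (hM.map_mem b hb)
  have hlt : finrank K W < N := by
    rw [← hN]
    refine Submodule.finrank_lt fun htop => ?_
    have hbot : L₁ ⊔ M₁ = ⊥ := by
      rw [htop] at hcompl
      exact disjoint_top.1 hcompl.disjoint
    obtain ⟨z, hz⟩ := exists_ne (0 : V)
    have hv0 : L₁ = ⊥ := (sup_eq_bot_iff.1 hbot).1
    have hz1 := hmax z
    rw [hv0, finrank_bot, Nat.le_zero, Submodule.finrank_eq_zero] at hz1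
    exact hz ((Submodule.mem_bot K).1 (hz1 ▸ self_mem_krylov T z))
  obtain ⟨L₂, M₂, hL₂, hM₂, htop⟩ := ih _ hlt W (B.restrict W) (T.restrict hW) rfl
    (fun z => hB.self_eq_zero z)
    (by
      intro z hz
      refine Subtype.ext (hnd z fun y => ?_)
      obtain ⟨a, ha, b, hb, rfl⟩ := Submodule.mem_sup.1
        (hcompl.sup_eq_top ▸ Submodule.mem_top : y ∈ (L₁ ⊔ M₁) ⊔ W)
      have h1 : B z a = 0 := by rw [hB.eq_iff]; exact horth a ha z z.2
      have h2 : B z b = 0 := hz ⟨b, hb⟩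
      rw [map_add, h1, h2, add_zero])
    (fun u z => hT u z)
  refine ⟨L₁ ⊔ L₂.map W.subtype, M₁ ⊔ M₂.map W.subtype,
    hL.sup_map hB hW (fun u hu => horth u (Submodule.mem_sup_left hu)) hL₂,
    hM.sup_map hB hW (fun u hu => horth u (Submodule.mem_sup_right hu)) hM₂, ?_⟩
  rw [sup_sup_sup_comm, ← Submodule.map_sup, htop, Submodule.map_subtype_top, hcompl.sup_eq_top]

/-- A Darboux basis whose two halves span invariant isotropic subspaces. -/
theorem exists_darboux_family [NeZero (2 : K)] [FiniteDimensional K V] {n : ℕ}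
    {B : LinearMap.BilinForm K V} {T : V →ₗ[K] V} (hn : finrank K V = n + n) (hB : B.IsAlt)
    (hnd : ∀ u, (∀ w, B u w = 0) → u = 0) (hT : ∀ u w, B (T u) w = B u (T w)) :
    ∃ e f : Fin n → V, (∀ i j, B (e i) (e j) = 0) ∧ (∀ i j, B (f i) (f j) = 0) ∧
      (∀ i j, B (f i) (e j) = if i = j then 1 else 0) ∧
      (∀ i j, B (e i) (T (e j)) = 0) ∧ (∀ i j, B (f i) (T (f j)) = 0) := by
  obtain ⟨L, M, hL, hM, htop⟩ := exists_invariantIsotropic_sup_eq_top _ V B T rfl hB hnd hT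
  have hLM : ∀ u ∈ L, (∀ w ∈ M, B u w = 0) → u = 0 := by
    intro u hu h
    refine hnd u fun y => ?_
    obtain ⟨a, ha, b, hb, rfl⟩ := Submodule.mem_sup.1 (htop ▸ Submodule.mem_top : y ∈ L ⊔ M)
    rw [map_add, hL.isotropic u hu a ha, h b hb, add_zero]
  have hML : ∀ u ∈ M, (∀ w ∈ L, B u w = 0) → u = 0 := by
    intro u hu h
    refine hnd u fun y => ?_
    obtain ⟨a, ha, b, hb, rfl⟩ := Submodule.mem_sup.1 (htop ▸ Submodule.mem_top : y ∈ L ⊔ M)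
    rw [map_add, hM.isotropic u hu b hb, h a ha, add_zero]
  have hcompl : IsCompl L M := by
    refine ⟨Submodule.disjoint_def.2 fun u hu hu' => hLM u hu fun w hw => ?_,
      codisjoint_iff.2 htop⟩
    exact hM.isotropic u hu' w hw
  have hdim : finrank K L = finrank K M :=
    le_antisymm (finrank_le_of_pairing hLM) (finrank_le_of_pairing hML)
  have hsum := Submodule.finrank_add_eq_of_isCompl hcompl
  have hLn : finrank K L = n := by omega
  have hsurj := pairing_surjective hML hdim.le
  let b : Basis (Fin n) K L := finBasisOfFinrankEq K L hLn
  choose f hf using fun i => hsurj (b.coord i)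
  refine ⟨fun i => b i, fun i => f i, fun i j => hL.isotropic _ (b i).2 _ (b j).2,
    fun i j => hM.isotropic _ (f i).2 _ (f j).2, fun i j => ?_,
    fun i j => hL.isotropic _ (b i).2 _ (hL.map_mem _ (b j).2),
    fun i j => hM.isotropic _ (f i).2 _ (hM.map_mem _ (f j).2)⟩
  have h : B (f i) (b j) = b.coord i (b j) := LinearMap.congr_fun (hf i) (b j)
  rw [h, Basis.coord_apply, Basis.repr_self, Finsupp.single_apply]
  simp only [eq_comm]

end AlternatingForm

lemma J_mul_self (n : ℕ) : J n * J n = -1 := Matrix.J_squared (Fin n) ℂ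

lemma transpose_J (n : ℕ) : (J n)ᵀ = -J n := Matrix.J_transpose (Fin n) ℂ

lemma isUnit_J (n : ℕ) : IsUnit (J n) :=
  IsUnit.of_mul_eq_one (-J n) (by rw [mul_neg, J_mul_self, neg_neg])

lemma transpose_mul_J_of_sadj_eq {n : ℕ} {x : Matrix (Fin n ⊕ Fin n) (Fin n ⊕ Fin n) ℂ}
    (hx : sadj n x = x) : xᵀ * J n = J n * x := by
  conv_rhs => rw [← hx, sadj, Matrix.mul_assoc,
    Matrix.mul_nonsing_inv_cancel_left _ _ ((Matrix.isUnit_iff_isUnit_det _).1 (isUnit_J n))]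

/-- A `J`-self-adjoint matrix is brought into block form by a matrix `P` preserving `J`. -/
lemma exists_symplectic_block_form {n : ℕ} {x : Matrix (Fin n ⊕ Fin n) (Fin n ⊕ Fin n) ℂ}
    (hx : xᵀ * J n = J n * x) :
    ∃ P : Matrix (Fin n ⊕ Fin n) (Fin n ⊕ Fin n) ℂ, Pᵀ * J n * P = J n ∧
      (Pᵀ * (J n * x) * P).toBlocks₁₁ = 0 ∧ (Pᵀ * (J n * x) * P).toBlocks₂₂ = 0 := by
  let B := Matrix.toBilin' (J n)
  have hBapp : ∀ u w, B u w = u ⬝ᵥ J n *ᵥ w := Matrix.toBilin'_apply' (J n)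
  have hneg : ∀ u w, B u w = -B w u := by
    intro u w
    rw [hBapp, hBapp, Matrix.dotProduct_mulVec, ← Matrix.mulVec_transpose, transpose_J,
      Matrix.neg_mulVec, neg_dotProduct, dotProduct_comm]
  have hB : B.IsAlt := by
    intro u
    have h := hneg u u
    have h2 : (2 : ℂ) * B u u = 0 := by linear_combination h
    exact (mul_eq_zero.1 h2).resolve_left two_ne_zero
  have hnd : ∀ u, (∀ w, B u w = 0) → u = 0 := by
    intro u h
    refine dotProduct_eq_zero u fun w => ?_
    have h1 := h (-(J n *ᵥ w))
    rwa [hBapp, Matrix.mulVec_neg, Matrix.mulVec_mulVec, J_mul_self, Matrix.neg_mulVec, neg_neg,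
      Matrix.one_mulVec] at h1
  have hT : ∀ u w, B (x.mulVecLin u) w = B u (x.mulVecLin w) := by
    intro u w
    rw [hBapp, hBapp, Matrix.mulVecLin_apply, Matrix.mulVecLin_apply, Matrix.mulVec_mulVec, ← hx,
      ← Matrix.mulVec_mulVec, Matrix.dotProduct_mulVec u, Matrix.vecMul_transpose]
  obtain ⟨e, f, hee, hff, hfe, heTe, hfTf⟩ := exists_darboux_family (n := n) (by simp) hB hnd hT
  let P : Matrix (Fin n ⊕ Fin n) (Fin n ⊕ Fin n) ℂ := Matrix.of fun i j => Sum.elim e f j i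
  have hentry : ∀ (Q : Matrix (Fin n ⊕ Fin n) (Fin n ⊕ Fin n) ℂ) i j,
      (Pᵀ * Q * P) i j = Sum.elim e f i ⬝ᵥ Q *ᵥ Sum.elim e f j := by
    intro Q i j
    rw [Matrix.mul_assoc]
    rfl
  refine ⟨P, ?_, ?_, ?_⟩
  · ext i j
    rw [hentry, ← hBapp]
    rcases i with i | i <;> rcases j with j | j
    · simp [hee, _root_.J]
    · simp [hneg (e i), hfe, _root_.J, Matrix.one_apply, eq_comm]
    · simp [hfe, _root_.J, Matrix.one_apply]
    · simp [hff, _root_.J]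
  · ext i j
    rw [Matrix.toBlocks₁₁, Matrix.of_apply, hentry, ← Matrix.mulVec_mulVec, ← hBapp]
    exact heTe i j
  · ext i j
    rw [Matrix.toBlocks₂₂, Matrix.of_apply, hentry, ← Matrix.mulVec_mulVec, ← hBapp]
    exact hfTf i j

/-- Every `x ∈ M_{2n}(ℂ)` with `x* = x` is symplectically similar to `X ⊕ Xᵀ`
for some `X ∈ M_n(ℂ)`; in particular `tr(x^k) = 2 tr(X^k)` for all `k ≥ 1`. -/
theorem selfadjoint_symplectically_similar (n : ℕ)
    (x : Matrix (Fin n ⊕ Fin n) (Fin n ⊕ Fin n) ℂ) (hx : sadj n x = x) :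
    ∃ (A : Matrix (Fin n ⊕ Fin n) (Fin n ⊕ Fin n) ℂ) (X : Matrix (Fin n) (Fin n) ℂ),
      Aᵀ * J n * A = J n ∧ IsUnit A ∧
      A * x * A⁻¹ = Matrix.fromBlocks X 0 0 Xᵀ ∧
      ∀ k : ℕ, 1 ≤ k → Matrix.trace (x ^ k) = 2 * Matrix.trace (X ^ k) := by
  have hxJ := transpose_mul_J_of_sadj_eq hx
  obtain ⟨P, hP, h₁₁, h₂₂⟩ := exists_symplectic_block_form hxJ
  have hleft : (-(J n) * Pᵀ * J n) * P = 1 := by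
    rw [Matrix.mul_assoc, Matrix.mul_assoc, ← Matrix.mul_assoc Pᵀ, hP, Matrix.neg_mul, J_mul_self,
      neg_neg]
  have hright := mul_eq_one_comm.1 hleft
  set A := -(J n) * Pᵀ * J n with hA
  have hAinv : A⁻¹ = P := Matrix.inv_eq_right_inv hleft
  have hAJ : Aᵀ * J n * A = J n := by
    have hright' : Aᵀ * Pᵀ = 1 := by rw [← Matrix.transpose_mul, hright, Matrix.transpose_one]
    calc Aᵀ * J n * A = Aᵀ * (Pᵀ * J n * P) * A := by rw [hP]
      _ = (Aᵀ * Pᵀ) * J n * (P * A) := by simp only [Matrix.mul_assoc]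
      _ = J n := by rw [hright', hright, Matrix.one_mul, Matrix.mul_one]
  set G := Pᵀ * (J n * x) * P with hG
  have hGskew : Gᵀ = -G := by
    rw [hG, Matrix.transpose_mul, Matrix.transpose_mul, Matrix.transpose_mul, transpose_J,
      Matrix.transpose_transpose, Matrix.mul_neg, hxJ]
    simp [Matrix.mul_assoc]
  have hAxP : A * x * P = -(J n) * G := by
    rw [hA, hG]; simp only [Matrix.mul_assoc]
  have hGblocks : G = fromBlocks 0 (-G.toBlocks₂₁ᵀ) G.toBlocks₂₁ 0 := by
    have h₁₂ : G.toBlocks₁₂ = -G.toBlocks₂₁ᵀ := by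
      ext i j
      have h := congrFun (congrFun hGskew (Sum.inr j)) (Sum.inl i)
      simpa [Matrix.toBlocks₁₂, Matrix.toBlocks₂₁] using h
    rw [← h₁₂]
    conv_lhs => rw [← fromBlocks_toBlocks G, h₁₁, h₂₂]
  have hform : A * x * A⁻¹ = fromBlocks G.toBlocks₂₁ 0 0 G.toBlocks₂₁ᵀ := by
    rw [hAinv, hAxP]
    conv_lhs => rw [hGblocks]
    simp [_root_.J, fromBlocks_multiply, fromBlocks_neg]
  refine ⟨A, G.toBlocks₂₁, hAJ, IsUnit.of_mul_eq_one P hleft, hform, fun k _ => ?_⟩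
  have hpow : A * x ^ k * P = (A * x * P) ^ k := by
    clear * - hleft hright
    induction k with
    | zero => simp [hleft]
    | succ k ih =>
      rw [pow_succ (A * x * P), ← ih, pow_succ]
      calc A * (x ^ k * x) * P = A * x ^ k * 1 * x * P := by simp only [Matrix.mul_assoc,
            Matrix.one_mul]
        _ = A * x ^ k * P * (A * x * P) := by rw [← hright]; simp only [Matrix.mul_assoc]
  calc trace (x ^ k) = trace (A * x ^ k * P) := by
        rw [Matrix.trace_mul_comm, ← Matrix.mul_assoc, hright, Matrix.one_mul]
    _ = 2 * trace (G.toBlocks₂₁ ^ k) := by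
        rw [hpow, ← hAinv, hform, fromBlocks_diagonal_pow, ← Matrix.transpose_pow]
        simp only [Matrix.trace, Matrix.diag_apply, Fintype.sum_sum_type, fromBlocks_apply₁₁,
          fromBlocks_apply₂₂, Matrix.transpose_apply, two_mul]
end
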